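/- Fix η ∈ (0, 1/2). For any integers d ≥ 2, N ≥ 1, and any point a ∈ W, the proportion of vertices v ∈ V with dist_d(a, v) ∈ [√B_{a,V} − 1/d^η, √B_{a,V} + 1/d^η] is at least 1 − 1/d^{1−2η}, where B_{a,V} = A_{a,V}(d,N)/(d N²). -/

import Mathlib

/-- Euclidean distance between two points of `ℝ^d`. -/
noncomputable def dE {d : ℕ} (x y : Fin d → ℝ) : ℝ :=
  Real.sqrt (∑ i, (x i - y i) ^ 2)

/-- Normalized distance `dist(x,y)/(√d · N)`. -/
noncomputable def dn (d N : ℕ) (x y : Fin d → ℝ) : ℝ :=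
  dE x y / (Real.sqrt d * N)

/-- The lattice points `{0,1,…,N}^d` of the hypercube `[0,N]^d`. -/
noncomputable def cubeW (d N : ℕ) : Finset (Fin d → ℝ) :=
  Finset.image (fun f : Fin d → Fin (N + 1) => fun i => (f i : ℝ)) Finset.univ

/-- The `2^d` vertices `{0,N}^d` of the hypercube `[0,N]^d`. -/
noncomputable def cubeV (d N : ℕ) : Finset (Fin d → ℝ) :=
  Finset.image (fun f : Fin d → Bool => fun i => if f i then (N : ℝ) else 0) Finset.univ

/-- The center `(N/2, …, N/2)` of the hypercube `[0,N]^d`. -/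
noncomputable def ctr (d N : ℕ) : Fin d → ℝ := fun _ => (N : ℝ) / 2

/-- Average of squared Euclidean distances from `a` to the vertices. -/
noncomputable def A_V (d N : ℕ) (a : Fin d → ℝ) : ℝ :=
  (∑ v ∈ cubeV d N, dE v a ^ 2) / 2 ^ d

/-- Normalized average of squared distances from `a` to the vertices. -/
noncomputable def B_V (d N : ℕ) (a : Fin d → ℝ) : ℝ :=
  A_V d N a / (d * (N : ℝ) ^ 2)

/-- Average of squared Euclidean distances from `a` to the lattice points. -/
noncomputable def A_W (d N : ℕ) (a : Fin d → ℝ) : ℝ :=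
  (∑ w ∈ cubeW d N, dE w a ^ 2) / ((N : ℝ) + 1) ^ d

/-- Normalized average of squared distances from `a` to the lattice points. -/
noncomputable def B_W (d N : ℕ) (a : Fin d → ℝ) : ℝ :=
  A_W d N a / (d * (N : ℝ) ^ 2)

open Classical in
/-- Number of elements of a finite set satisfying a predicate. -/
noncomputable def pcount {α : Type*} (s : Finset α) (p : α → Prop) : ℕ :=
  (s.filter p).card

open Classical in
/-- Ordered pairs of vertices forming a non-degenerate triangle with `a`. -/
noncomputable def TaV (d N : ℕ) (a : Fin d → ℝ) : Finset ((Fin d → ℝ) × (Fin d → ℝ)) :=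
  ((cubeV d N) ×ˢ (cubeV d N)).filter (fun p => a ≠ p.1 ∧ a ≠ p.2 ∧ p.1 ≠ p.2)

open Classical in
/-- Ordered pairs of lattice points forming a non-degenerate triangle with `a`. -/
noncomputable def TaW (d N : ℕ) (a : Fin d → ℝ) : Finset ((Fin d → ℝ) × (Fin d → ℝ)) :=
  ((cubeW d N) ×ˢ (cubeW d N)).filter (fun p => a ≠ p.1 ∧ a ≠ p.2 ∧ p.1 ≠ p.2)

/-- Cosine of the angle at `c` in the triangle `(a, c, v)`. -/
noncomputable def cosAngleAt {d : ℕ} (c a v : Fin d → ℝ) : ℝ :=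
  (∑ i, (a i - c i) * (v i - c i)) / (dE a c * dE v c)

/-- The sign `±1` attached to a Boolean. -/
def boolSign (b : Bool) : ℝ := if b then 1 else -1

theorem sum_add_signed_sum (d : ℕ) (c : Fin d → ℝ) (x : ℝ) :
    ∑ f : Fin d → Bool, (x + ∑ i, boolSign (f i) * c i) = 2 ^ d * x := by
  induction d generalizing x with
  | zero => simp
  | succ d ih =>
    rw [← (Fin.consEquiv fun _ => Bool).sum_comp, Fintype.sum_prod_type]
    simp only [Fin.consEquiv_apply, Fin.sum_univ_succ, Fin.cons_zero, Fin.cons_succ, ← add_assoc,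
      ih, Fintype.sum_bool]
    simp only [boolSign, if_true, Bool.false_eq_true, if_false]
    ring

theorem sum_sq_add_signed_sum (d : ℕ) (c : Fin d → ℝ) (x : ℝ) :
    ∑ f : Fin d → Bool, (x + ∑ i, boolSign (f i) * c i) ^ 2 = 2 ^ d * (x ^ 2 + ∑ i, c i ^ 2) := by
  induction d generalizing x with
  | zero => simp
  | succ d ih =>
    rw [← (Fin.consEquiv fun _ => Bool).sum_comp, Fintype.sum_prod_type]
    simp only [Fin.consEquiv_apply, Fin.sum_univ_succ, Fin.cons_zero, Fin.cons_succ, ← add_assoc,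
      ih, Fintype.sum_bool]
    simp only [boolSign, if_true, Bool.false_eq_true, if_false]
    ring

theorem cubeV_map_injective {d N : ℕ} (hN : 1 ≤ N) :
    Function.Injective
      (fun (f : Fin d → Bool) (i : Fin d) => if f i then (N : ℝ) else 0) := by
  intro f g h
  have hN' : (0 : ℝ) ≠ N := by positivity
  funext i
  have hi := congrFun h i
  cases hf : f i <;> cases hg : g i <;> simp_all

theorem sum_cubeV {d N : ℕ} (hN : 1 ≤ N) (F : (Fin d → ℝ) → ℝ) :
    ∑ v ∈ cubeV d N, F v = ∑ f : Fin d → Bool, F fun i => if f i then (N : ℝ) else 0 :=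
  Finset.sum_image (cubeV_map_injective hN).injOn

theorem card_cubeV {d N : ℕ} (hN : 1 ≤ N) : (cubeV d N).card = 2 ^ d := by
  rw [cubeV, Finset.card_image_of_injective _ (cubeV_map_injective hN)]
  simp

theorem dE_comm {d : ℕ} (x y : Fin d → ℝ) : dE x y = dE y x := by
  simp only [dE, sub_sq_comm]

theorem dE_nonneg {d : ℕ} (x y : Fin d → ℝ) : 0 ≤ dE x y := Real.sqrt_nonneg _

theorem dE_sq {d : ℕ} (x y : Fin d → ℝ) : dE x y ^ 2 = ∑ i, (x i - y i) ^ 2 :=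
  Real.sq_sqrt (Finset.sum_nonneg fun _ _ => sq_nonneg _)

theorem dE_vertex_sq {d : ℕ} (N : ℕ) (a : Fin d → ℝ) (f : Fin d → Bool) :
    dE (fun i => if f i then (N : ℝ) else 0) a ^ 2 =
      ∑ i, (a i ^ 2 + (N - a i) ^ 2) / 2 +
        ∑ i, boolSign (f i) * (((N : ℝ) ^ 2 - 2 * N * a i) / 2) := by
  rw [dE_sq, ← Finset.sum_add_distrib]
  refine Finset.sum_congr rfl fun i _ => ?_
  cases f i <;> simp [boolSign] <;> ring

theorem A_V_eq {d N : ℕ} (hN : 1 ≤ N) (a : Fin d → ℝ) :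
    A_V d N a = ∑ i, (a i ^ 2 + (N - a i) ^ 2) / 2 := by
  simp only [A_V, sum_cubeV hN, dE_vertex_sq, sum_add_signed_sum]
  field_simp

theorem A_V_ge {d N : ℕ} (hN : 1 ≤ N) (a : Fin d → ℝ) : d * (N : ℝ) ^ 2 / 4 ≤ A_V d N a := by
  rw [A_V_eq hN]
  calc d * (N : ℝ) ^ 2 / 4 = ∑ _i : Fin d, (N : ℝ) ^ 2 / 4 := by simp; ring
    _ ≤ _ := Finset.sum_le_sum fun i _ => by nlinarith [sq_nonneg ((N : ℝ) - 2 * a i)]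

theorem sum_sq_dE_sq_sub_A_V {d N : ℕ} (hN : 1 ≤ N) (a : Fin d → ℝ) :
    ∑ v ∈ cubeV d N, (dE v a ^ 2 - A_V d N a) ^ 2 =
      2 ^ d * ∑ i, (((N : ℝ) ^ 2 - 2 * N * a i) / 2) ^ 2 := by
  rw [sum_cubeV hN, A_V_eq hN]
  simp only [dE_vertex_sq, add_sub_cancel_left]
  simpa using sum_sq_add_signed_sum d (fun i => ((N : ℝ) ^ 2 - 2 * N * a i) / 2) 0

theorem mem_Icc_of_mem_cubeW {d N : ℕ} {a : Fin d → ℝ} (ha : a ∈ cubeW d N) (i : Fin d) :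
    a i ∈ Set.Icc (0 : ℝ) N := by
  obtain ⟨f, -, rfl⟩ := Finset.mem_image.1 ha
  exact ⟨Nat.cast_nonneg _, Nat.cast_le.2 (Nat.lt_succ_iff.1 (f i).2)⟩

theorem sum_sq_dE_sq_sub_A_V_le {d N : ℕ} (hN : 1 ≤ N) {a : Fin d → ℝ} (ha : a ∈ cubeW d N) :
    ∑ v ∈ cubeV d N, (dE v a ^ 2 - A_V d N a) ^ 2 ≤ 2 ^ d * (d * (N : ℝ) ^ 4 / 4) := by
  rw [sum_sq_dE_sq_sub_A_V hN]
  gcongr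
  calc ∑ i, (((N : ℝ) ^ 2 - 2 * N * a i) / 2) ^ 2 ≤ ∑ _i : Fin d, (N : ℝ) ^ 4 / 4 :=
        Finset.sum_le_sum fun i _ => by
          obtain ⟨h0, h1⟩ := mem_Icc_of_mem_cubeW ha i
          nlinarith [mul_nonneg (sq_nonneg (N : ℝ)) (mul_nonneg h0 (sub_nonneg.2 h1))]
    _ = d * (N : ℝ) ^ 4 / 4 := by simp; ring

theorem mul_sq_sub_sqrt_le {x m : ℝ} (hx : 0 ≤ x) (hm : 0 ≤ m) :
    m * (x - √m) ^ 2 ≤ (x ^ 2 - m) ^ 2 := by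
  obtain ⟨s, hs, rfl⟩ : ∃ s, 0 ≤ s ∧ m = s ^ 2 := ⟨√m, Real.sqrt_nonneg m, (Real.sq_sqrt hm).symm⟩
  rw [Real.sqrt_sq hs, ← mul_pow]
  have h : (x ^ 2 - s ^ 2) ^ 2 = (x + s) ^ 2 * (x - s) ^ 2 := by ring
  rw [h, mul_pow]
  gcongr
  linarith

theorem dn_sub_sqrt_B_V (d N : ℕ) (a v : Fin d → ℝ) :
    dn d N a v - √(B_V d N a) = (dE v a - √(A_V d N a)) / (√d * N) := by
  have h : √((d : ℝ) * (N : ℝ) ^ 2) = √d * N := by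
    rw [Real.sqrt_mul (Nat.cast_nonneg d), Real.sqrt_sq (Nat.cast_nonneg N)]
  rw [dn, B_V, Real.sqrt_div' _ (by positivity), h, dE_comm, sub_div]

theorem sum_sq_dn_sub_sqrt_B_V_le {d N : ℕ} (hd : 1 ≤ d) (hN : 1 ≤ N) {a : Fin d → ℝ}
    (ha : a ∈ cubeW d N) :
    ∑ v ∈ cubeV d N, (dn d N a v - √(B_V d N a)) ^ 2 ≤ 2 ^ d / d := by
  have hN' : (0 : ℝ) < N := by exact_mod_cast hN
  have hd' : (0 : ℝ) < d := by exact_mod_cast hd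
  have hA := A_V_ge hN a
  have hK : (0 : ℝ) < (d * (N : ℝ) ^ 2) ^ 2 / 4 := by positivity
  have hle : (d * (N : ℝ) ^ 2) ^ 2 / 4 * ∑ v ∈ cubeV d N, (dn d N a v - √(B_V d N a)) ^ 2 ≤
      2 ^ d * (d * (N : ℝ) ^ 4 / 4) := by
    rw [Finset.mul_sum]
    refine (Finset.sum_le_sum fun v _ => ?_).trans (sum_sq_dE_sq_sub_A_V_le hN ha)
    rw [dn_sub_sqrt_B_V]
    calc (d * (N : ℝ) ^ 2) ^ 2 / 4 * ((dE v a - √(A_V d N a)) / (√d * N)) ^ 2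
        = d * (N : ℝ) ^ 2 / 4 * (dE v a - √(A_V d N a)) ^ 2 := by
          rw [div_pow, mul_pow (√(d : ℝ)), Real.sq_sqrt hd'.le]
          field_simp
      _ ≤ A_V d N a * (dE v a - √(A_V d N a)) ^ 2 := by gcongr
      _ ≤ _ := mul_sq_sub_sqrt_le (dE_nonneg v a) (le_trans (by positivity) hA)
  refine le_of_mul_le_mul_left (hle.trans_eq ?_) hK
  field_simp

/-- Chebyshev's inequality for the counting measure on a finite set. -/
theorem card_sub_pcount_mul_sq_le {α : Type*} (s : Finset α) (g : α → ℝ) (c : ℝ) {δ : ℝ}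
    (hδ : 0 ≤ δ) :
    ((s.card : ℝ) - pcount s fun v => g v ∈ Set.Icc (c - δ) (c + δ)) * δ ^ 2 ≤
      ∑ v ∈ s, (g v - c) ^ 2 := by
  classical
  have hcard : ((s.card : ℝ) - pcount s fun v => g v ∈ Set.Icc (c - δ) (c + δ)) =
      (s.filter fun v => ¬ g v ∈ Set.Icc (c - δ) (c + δ)).card := by
    rw [sub_eq_iff_eq_add', pcount]
    norm_cast
    convert (Finset.card_filter_add_card_filter_not _).symm
  rw [hcard, ← nsmul_eq_mul]
  refine (Finset.card_nsmul_le_sum _ _ _ fun v hv => ?_).trans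
    (Finset.sum_le_sum_of_subset_of_nonneg (Finset.filter_subset _ s) fun _ _ _ => sq_nonneg _)
  have hout := (Finset.mem_filter.1 hv).2
  rw [← sq_abs (g v - c)]
  refine pow_le_pow_left₀ hδ (le_of_not_gt fun hlt => hout ?_) 2
  obtain ⟨h1, h2⟩ := abs_lt.1 hlt
  constructor <;> linarith

theorem stmt5 (η : ℝ) (hη : η ∈ Set.Ioo (0 : ℝ) (1 / 2)) (d N : ℕ) (hd : 2 ≤ d) (hN : 1 ≤ N)
    (a : Fin d → ℝ) (ha : a ∈ cubeW d N) :
    (1 : ℝ) - 1 / (d : ℝ) ^ ((1 : ℝ) - 2 * η) ≤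
      (pcount (cubeV d N) (fun v =>
          dn d N a v ∈ Set.Icc (Real.sqrt (B_V d N a) - 1 / (d : ℝ) ^ η)
            (Real.sqrt (B_V d N a) + 1 / (d : ℝ) ^ η)) : ℝ) / (cubeV d N).card := by
  have hd' : (0 : ℝ) < d := by positivity
  have hpow : (d : ℝ) ^ ((1 : ℝ) - 2 * η) = d / ((d : ℝ) ^ η) ^ 2 := by
    rw [Real.rpow_sub hd', Real.rpow_one, mul_comm, Real.rpow_mul hd'.le, Real.rpow_two]
  have hη' : (0 : ℝ) < (d : ℝ) ^ η := Real.rpow_pos_of_pos hd' η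
  have hcheb := (card_sub_pcount_mul_sq_le (cubeV d N) (dn d N a) (√(B_V d N a))
    (one_div_pos.2 hη').le).trans (sum_sq_dn_sub_sqrt_B_V_le (by omega) hN ha)
  rw [div_pow, one_pow, mul_one_div, div_le_iff₀ (by positivity)] at hcheb
  rw [hpow, one_div_div, le_div_iff₀ (by rw [card_cubeV hN]; positivity)]
  rw [card_cubeV hN] at hcheb ⊢
  push_cast at hcheb ⊢
  have h : (2 : ℝ) ^ d / d * ((d : ℝ) ^ η) ^ 2 = ((d : ℝ) ^ η) ^ 2 / d * 2 ^ d := by ring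
  linarith
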